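/- arXiv:1108.5343 — 2 statements merged into one kernel-verified Lean document; each statement's English description precedes it below -/
import Mathlib

section
/- Let n ≥ 2 and l ∈ ℕ₀. There exists a polynomial P_l of degree l with integer coefficients such that for all z = (x,t) ∈ ℝ^{n+1}_+ and w = (y,s) ∈ ℝ^{n+1}_+: ∂^l/∂t^l (|z − w̄|^{1−n}) = |z − w̄|^{−(n−1+l)} · P_l( (t+s)·|z − w̄|^{−1} ). In particular the function z ↦ ∂^l/∂t^l (|z − w̄|^{1−n}) is harmonic on ℝ^{n+1}_+. -/
open MeasureTheory Real Set
open scoped ENNReal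

noncomputable section

abbrev Euc (N : ℕ) : Type := EuclideanSpace ℝ (Fin N)

/-- The point `(x, t) ∈ ℝ^{n+1}`. -/
def pt {n : ℕ} (x : Euc n) (t : ℝ) : Euc (n + 1) :=
  (EuclideanSpace.equiv (Fin (n + 1)) ℝ).symm (Fin.snoc (fun i => x i) t)

/-- horizontal part of a point of ℝ^{n+1} -/
def xp {n : ℕ} (z : Euc (n + 1)) : Euc n :=
  (EuclideanSpace.equiv (Fin n) ℝ).symm (fun i => z i.castSucc)

/-- vertical part of a point of ℝ^{n+1} -/
def tp {n : ℕ} (z : Euc (n + 1)) : ℝ := z (Fin.last n)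

/-- The upper half space ℝ^{n+1}_+. -/
def upperHS (n : ℕ) : Set (Euc (n + 1)) := {z | 0 < tp z}

/-- |z - w̄| where z = (x,t), w̄ = (y, -s): Euclidean distance -/
def dB {n : ℕ} (x : Euc n) (t : ℝ) (y : Euc n) (s : ℝ) : ℝ :=
  dist (pt x t) (pt y (-s))

/-- the measure t^λ dx dt on ℝ^n × (0,∞), identified with ℝ^{n+1}_+ -/
def mLam (n : ℕ) (l : ℝ) : Measure (Euc n × ℝ) :=
  ((volume : Measure (Euc n)).prod ((volume : Measure ℝ).restrict (Ioi 0))).withDensity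
    (fun zt => ENNReal.ofReal (zt.2 ^ l))

/-- second derivative of `f` at `z` along direction `v` -/
def d2 {V : Type*} [NormedAddCommGroup V] [NormedSpace ℝ V] (f : V → ℝ) (z v : V) : ℝ :=
  iteratedFDeriv ℝ 2 f z ![v, v]

/-- `f` is harmonic on a subset of ℝ^N : twice continuously differentiable with
vanishing Laplacian. -/
def HarmonicOnE {N : ℕ} (f : Euc N → ℝ) (s : Set (Euc N)) : Prop :=
  ContDiffOn ℝ 2 f s ∧ ∀ z ∈ s, ∑ i, d2 f z (EuclideanSpace.single i 1) = 0

/-- `f` is harmonic on (ℝ^{n+1}_+)^m, viewed as an open subset of ℝ^{m(n+1)}. -/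
def HarmonicOnM {n m : ℕ} (f : (Fin m → Euc (n + 1)) → ℝ) : Prop :=
  ContDiffOn ℝ 2 f {z | ∀ j, z j ∈ upperHS n} ∧
  ∀ z ∈ {z : Fin m → Euc (n + 1) | ∀ j, z j ∈ upperHS n},
    ∑ j, ∑ i, d2 f z (Function.update (0 : Fin m → Euc (n + 1)) j (EuclideanSpace.single i 1)) = 0

/-- `f` is harmonic in each variable separately on (ℝ^{n+1}_+)^m -/
def HarmonicSep {n m : ℕ} (f : (Fin m → Euc (n + 1)) → ℝ) : Prop :=
  ∀ (j : Fin m) (z : Fin m → Euc (n + 1)), (∀ k, z k ∈ upperHS n) →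
    HarmonicOnE (fun w => f (Function.update z j w)) (upperHS n)

/-- the closed cube centered at (y,s) with side length s -/
def Qcube {n : ℕ} (y : Euc n) (s : ℝ) : Set (Euc (n + 1)) :=
  {z | (∀ i : Fin n, |z (Fin.castSucc i) - y i| ≤ s / 2) ∧ |tp z - s| ≤ s / 2}

/-- the A^p_λ (quasi)-norm, raised to the power p -/
def normAp (n : ℕ) (f : Euc (n + 1) → ℝ) (p l : ℝ) : ℝ≥0∞ :=
  ∫⁻ zt : Euc n × ℝ, ENNReal.ofReal (|f (pt zt.1 zt.2)| ^ p) ∂(mLam n l)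

/-- membership in the harmonic Bergman space A^p_λ -/
def memAp (n : ℕ) (f : Euc (n + 1) → ℝ) (p l : ℝ) : Prop :=
  HarmonicOnE f (upperHS n) ∧ normAp n f p l < ⊤


/-- f_{w,l}(z) = ∂^l/∂t^l (|z - w̄|^{1-n}) for w = (y,s), z = (x,t) -/
def fwl (n l : ℕ) (y : Euc n) (s : ℝ) (z : Euc (n + 1)) : ℝ :=
  iteratedDeriv l (fun τ => dB (xp z) τ y s ^ (1 - (n : ℝ))) (tp z)

/-- The polynomials in the derivatives of `r ^ (1 - n)` with `r = √(a² + u²)`, evaluated at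
`u / r`. -/
def derivPoly (n : ℕ) : ℕ → Polynomial ℤ
  | 0 => 1
  | l + 1 => -Polynomial.C ((n : ℤ) - 1 + l) * (Polynomial.X * derivPoly n l) +
      (1 - Polynomial.X ^ 2) * Polynomial.derivative (derivPoly n l)

theorem natDegree_derivPoly_le (n l : ℕ) : (derivPoly n l).natDegree ≤ l := by
  induction l with
  | zero => simp [derivPoly]
  | succ l ih =>
    unfold derivPoly
    have hd : (Polynomial.derivative (derivPoly n l)).natDegree ≤ l - 1 :=
      (Polynomial.natDegree_derivative_le _).trans (Nat.sub_le_sub_right ih 1)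
    rcases Nat.eq_zero_or_pos l with rfl | hl
    · simp only [derivPoly, Polynomial.derivative_one, mul_zero, add_zero]
      compute_degree
    · refine Polynomial.natDegree_add_le_of_degree_le ?_ ?_
      · compute_degree
        omega
      · refine Polynomial.natDegree_mul_le.trans ?_
        have : (1 - Polynomial.X ^ 2 : Polynomial ℤ).natDegree ≤ 2 := by compute_degree
        omega

theorem coeff_derivPoly_succ_top (n l : ℕ) :
    (derivPoly n (l + 1)).coeff (l + 1) =
      -((n : ℤ) - 1 + 2 * l) * (derivPoly n l).coeff l := by
  rw [derivPoly, ← Polynomial.C_neg, Polynomial.coeff_add, Polynomial.coeff_C_mul,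
    Polynomial.coeff_X_mul, sub_mul, one_mul, Polynomial.coeff_sub, Polynomial.coeff_derivative,
    Polynomial.coeff_eq_zero_of_natDegree_lt
      (lt_of_le_of_lt (natDegree_derivPoly_le n l) (by omega : l < l + 1 + 1))]
  rcases l with _ | l
  · simp [derivPoly]
  · rw [show l + 1 + 1 = l + 2 by rfl, Polynomial.coeff_X_pow_mul, Polynomial.coeff_derivative]
    push_cast
    ring

theorem coeff_derivPoly_ne_zero {n : ℕ} (hn : 2 ≤ n) (l : ℕ) : (derivPoly n l).coeff l ≠ 0 := by
  induction l with
  | zero => simp [derivPoly]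
  | succ l ih =>
    rw [coeff_derivPoly_succ_top]
    refine mul_ne_zero ?_ ih
    omega

theorem natDegree_derivPoly {n : ℕ} (hn : 2 ≤ n) (l : ℕ) : (derivPoly n l).natDegree = l :=
  le_antisymm (natDegree_derivPoly_le n l)
    (Polynomial.le_natDegree_of_ne_zero (coeff_derivPoly_ne_zero hn l))

theorem dB_eq_sqrt {n : ℕ} (x y : Euc n) (t s : ℝ) :
    dB x t y s = √(dist x y ^ 2 + (t + s) ^ 2) := by
  rw [dB, EuclideanSpace.dist_eq, EuclideanSpace.dist_eq, Real.sq_sqrt (by positivity),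
    Fin.sum_univ_castSucc]
  simp [pt, Real.dist_eq, sq_abs]

theorem dB_pos {n : ℕ} (x y : Euc n) {t s : ℝ} (ht : 0 < t) (hs : 0 < s) : 0 < dB x t y s := by
  rw [dB_eq_sqrt]
  positivity

theorem hasDerivAt_dB {n : ℕ} (x y : Euc n) {t s : ℝ} (ht : 0 < t) (hs : 0 < s) :
    HasDerivAt (fun τ => dB x τ y s) ((t + s) / dB x t y s) t := by
  simp only [dB_eq_sqrt]
  have h : HasDerivAt (fun τ => dist x y ^ 2 + (τ + s) ^ 2) (2 * (t + s)) t := by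
    simpa using (((hasDerivAt_id t).add_const s).pow 2).const_add (dist x y ^ 2)
  convert h.sqrt (by positivity) using 1
  field_simp

theorem hasDerivAt_dB_rpow_mul_aeval {n : ℕ} (x y : Euc n) {t s : ℝ} (ht : 0 < t) (hs : 0 < s)
    (k : ℝ) (P : Polynomial ℤ) :
    HasDerivAt
      (fun τ => dB x τ y s ^ (-k) * Polynomial.aeval ((τ + s) / dB x τ y s) P)
      (dB x t y s ^ (-(k + 1)) *
        (-k * ((t + s) / dB x t y s) * Polynomial.aeval ((t + s) / dB x t y s) P +
          (1 - ((t + s) / dB x t y s) ^ 2) *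
            Polynomial.aeval ((t + s) / dB x t y s) (Polynomial.derivative P))) t := by
  have hd := hasDerivAt_dB x y ht hs
  have hp := dB_pos x y ht hs
  have hc := ((hasDerivAt_id t).add_const s).fun_div hd hp.ne'
  have hP := (P.hasDerivAt_aeval ((t + s) / dB x t y s)).comp t hc
  refine ((hd.rpow_const (p := -k) (Or.inl hp.ne')).fun_mul hP).congr_deriv ?_
  rw [show -k = -(k + 1) + 1 by ring, Real.rpow_add_one hp.ne', add_sub_cancel_right]
  simp only [id, Function.comp_apply]
  field_simp

theorem iteratedDeriv_dB_rpow {n : ℕ} (x y : Euc n) (l : ℕ) {t s : ℝ} (ht : 0 < t) (hs : 0 < s) :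
    iteratedDeriv l (fun τ => dB x τ y s ^ (1 - (n : ℝ))) t =
      dB x t y s ^ (-((n : ℝ) - 1 + l)) *
        Polynomial.aeval ((t + s) / dB x t y s) (derivPoly n l) := by
  induction l generalizing t with
  | zero => simp [derivPoly]
  | succ l ih =>
    rw [iteratedDeriv_succ]
    have he : iteratedDeriv l (fun τ => dB x τ y s ^ (1 - (n : ℝ))) =ᶠ[nhds t]
        fun τ => dB x τ y s ^ (-((n : ℝ) - 1 + l)) *
          Polynomial.aeval ((τ + s) / dB x τ y s) (derivPoly n l) := by
      filter_upwards [lt_mem_nhds ht] with τ hτ using ih hτ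
    rw [he.deriv_eq, (hasDerivAt_dB_rpow_mul_aeval x y ht hs _ _).deriv, derivPoly]
    simp
    ring_nf

section DirectionalDerivative

variable {V : Type*} [NormedAddCommGroup V] [NormedSpace ℝ V]

theorem fderiv_fderiv_apply {f : V → ℝ} {z : V} (hf : ContDiffAt ℝ 2 f z) (a b : V) :
    fderiv ℝ (fun x => fderiv ℝ f x a) z b = fderiv ℝ (fderiv ℝ f) z b a := by
  have hd : DifferentiableAt ℝ (fderiv ℝ f) z :=
    (hf.fderiv_right (m := 1) (by norm_num)).differentiableAt (by norm_num)
  rw [fderiv_clm_apply hd (differentiableAt_const a)]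
  simp

theorem fderiv_fderiv_apply_comm {f : V → ℝ} {z : V} (hf : ContDiffAt ℝ 2 f z) (a b : V) :
    fderiv ℝ (fun x => fderiv ℝ f x a) z b = fderiv ℝ (fun x => fderiv ℝ f x b) z a := by
  rw [fderiv_fderiv_apply hf, fderiv_fderiv_apply hf]
  exact (hf.isSymmSndFDerivAt (by simp)).eq b a

theorem d2_eq_fderiv_fderiv_apply {f : V → ℝ} {z : V} (hf : ContDiffAt ℝ 2 f z) (v : V) :
    d2 f z v = fderiv ℝ (fun x => fderiv ℝ f x v) z v := by
  simp [d2, iteratedFDeriv_two_apply, fderiv_fderiv_apply hf]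

theorem ContDiffOn.fderiv_apply_const {f : V → ℝ} {U : Set V} (hU : IsOpen U)
    (hf : ContDiffOn ℝ (⊤ : ℕ∞) f U) (e : V) :
    ContDiffOn ℝ (⊤ : ℕ∞) (fun z => fderiv ℝ f z e) U :=
  (hf.fderiv_of_isOpen hU (by simp)).clm_apply contDiffOn_const

/-- Second derivatives commute with directional derivatives. -/
theorem d2_fderiv_apply {f : V → ℝ} {U : Set V} (hU : IsOpen U)
    (hf : ContDiffOn ℝ (⊤ : ℕ∞) f U) {z : V} (hz : z ∈ U) (e v : V) :
    d2 (fun x => fderiv ℝ f x e) z v = fderiv ℝ (fun x => d2 f x v) z e := by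
  have h2 {g : V → ℝ} (hg : ContDiffOn ℝ (⊤ : ℕ∞) g U) {x : V} (hx : x ∈ U) :
      ContDiffAt ℝ 2 g x :=
    (hg.contDiffAt (hU.mem_nhds hx)).of_le (WithTop.coe_le_coe.2 le_top)
  have hswap : (fun x => fderiv ℝ (fun x => fderiv ℝ f x e) x v) =ᶠ[nhds z]
      fun x => fderiv ℝ (fun x => fderiv ℝ f x v) x e := by
    filter_upwards [hU.mem_nhds hz] with x hx using fderiv_fderiv_apply_comm (h2 hf hx) e v
  have hd2 : (fun x => d2 f x v) =ᶠ[nhds z]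
      fun x => fderiv ℝ (fun x => fderiv ℝ f x v) x v := by
    filter_upwards [hU.mem_nhds hz] with x hx using d2_eq_fderiv_fderiv_apply (h2 hf hx) v
  rw [d2_eq_fderiv_fderiv_apply (h2 (hf.fderiv_apply_const hU e) hz), hswap.fderiv_eq,
    hd2.fderiv_eq, fderiv_fderiv_apply_comm (h2 (hf.fderiv_apply_const hU v) hz)]

end DirectionalDerivative

theorem HarmonicOnE.fderiv_apply {N : ℕ} {f : Euc N → ℝ} {U : Set (Euc N)} (hU : IsOpen U)
    (hf : ContDiffOn ℝ (⊤ : ℕ∞) f U) (h : HarmonicOnE f U) (e : Euc N) :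
    HarmonicOnE (fun z => fderiv ℝ f z e) U := by
  refine ⟨(hf.fderiv_apply_const hU e).of_le (WithTop.coe_le_coe.2 le_top), fun z hz => ?_⟩
  have hdiff (i : Fin N) :
      DifferentiableAt ℝ (fun x => d2 f x (EuclideanSpace.single i 1)) z := by
    have hs := (hf.fderiv_apply_const hU (EuclideanSpace.single i 1)).fderiv_apply_const hU
      (EuclideanSpace.single i 1)
    refine ((hs.contDiffAt (hU.mem_nhds hz)).differentiableAt (by simp)).congr_of_eventuallyEq ?_
    filter_upwards [hU.mem_nhds hz] with x hx using d2_eq_fderiv_fderiv_apply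
      ((hf.contDiffAt (hU.mem_nhds hx)).of_le (WithTop.coe_le_coe.2 le_top)) _
  have hzero : (fun x => ∑ i, d2 f x (EuclideanSpace.single i 1)) =ᶠ[nhds z] fun _ => 0 := by
    filter_upwards [hU.mem_nhds hz] with x hx using h.2 x hx
  simp only [d2_fderiv_apply hU hf hz]
  rw [← sum_apply, ← fderiv_fun_sum fun i _ => hdiff i, hzero.fderiv_eq]
  simp

theorem HarmonicOnE.congr {N : ℕ} {f g : Euc N → ℝ} {U : Set (Euc N)} (hU : IsOpen U)
    (h : HarmonicOnE f U) (hg : EqOn g f U) : HarmonicOnE g U := by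
  refine ⟨h.1.congr hg, fun z hz => ?_⟩
  rw [← h.2 z hz]
  refine Finset.sum_congr rfl fun i _ => ?_
  have he : g =ᶠ[nhds z] f := by filter_upwards [hU.mem_nhds hz] with x hx using hg hx
  rw [d2, d2, (Filter.EventuallyEq.iteratedFDeriv ℝ he 2).eq_of_nhds]

theorem contDiffOn_dist_rpow {N : ℕ} (a : Euc N) (p : ℝ) :
    ContDiffOn ℝ (⊤ : ℕ∞) (fun z : Euc N => dist z a ^ p) {a}ᶜ := by
  intro z hz
  exact ((contDiffAt_id.dist ℝ contDiffAt_const hz).rpow_const_of_ne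
    (dist_ne_zero.2 hz)).contDiffWithinAt

theorem hasFDerivAt_dist_rpow {N : ℕ} (a : Euc N) (p : ℝ) {z : Euc N} (hz : z ≠ a) :
    HasFDerivAt (fun z : Euc N => dist z a ^ p)
      ((p * dist z a ^ (p - 2)) • innerSL ℝ (z - a)) z := by
  have hsq (z : Euc N) : (‖z - a‖ ^ 2) ^ (p / 2) = dist z a ^ p := by
    rw [← dist_eq_norm, ← Real.rpow_natCast_mul dist_nonneg]
    congr 1
    push_cast
    ring
  have h := (((hasFDerivAt_id z).sub_const a).norm_sq).rpow_const (p := p / 2)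
    (Or.inl (by simpa [sub_eq_zero] using hz))
  simp only [id, hsq] at h
  refine h.congr_fderiv ?_
  rw [show p - 2 = (2 : ℕ) * (p / 2 - 1) by push_cast; ring,
    Real.rpow_natCast_mul dist_nonneg, dist_eq_norm]
  ext w
  simp
  ring

theorem d2_dist_rpow {N : ℕ} (a : Euc N) (p : ℝ) {z : Euc N} (hz : z ≠ a) (v : Euc N) :
    d2 (fun z : Euc N => dist z a ^ p) z v =
      p * (p - 2) * dist z a ^ (p - 4) * inner ℝ (z - a) v ^ 2 +
        p * dist z a ^ (p - 2) * ‖v‖ ^ 2 := by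
  have hU : IsOpen ({a}ᶜ : Set (Euc N)) := isOpen_compl_singleton
  rw [d2_eq_fderiv_fderiv_apply
    (((contDiffOn_dist_rpow a p).contDiffAt (hU.mem_nhds hz)).of_le (WithTop.coe_le_coe.2 le_top))]
  have he : (fun x => fderiv ℝ (fun z : Euc N => dist z a ^ p) x v) =ᶠ[nhds z]
      fun x => p * dist x a ^ (p - 2) * inner ℝ (x - a) v := by
    filter_upwards [hU.mem_nhds hz] with x hx
    rw [(hasFDerivAt_dist_rpow a p hx).fderiv, smul_apply, innerSL_apply_apply, smul_eq_mul]
  have hin : HasFDerivAt (fun x : Euc N => inner ℝ (x - a) v) (innerSL ℝ v) z := by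
    refine (((hasFDerivAt_id z).sub_const a).inner ℝ (hasFDerivAt_const v z)).congr_fderiv ?_
    ext w
    simp [real_inner_comm]
  rw [he.fderiv_eq, (((hasFDerivAt_dist_rpow a (p - 2) hz).const_mul p).fun_mul hin).fderiv]
  simp only [add_apply, smul_apply, innerSL_apply_apply, smul_eq_mul,
    real_inner_self_eq_norm_sq]
  ring_nf

theorem harmonicOnE_dist_rpow {N : ℕ} (a : Euc N) :
    HarmonicOnE (fun z : Euc N => dist z a ^ (2 - (N : ℝ))) {a}ᶜ := by
  refine ⟨(contDiffOn_dist_rpow a _).of_le (WithTop.coe_le_coe.2 le_top), fun z hz => ?_⟩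
  have hpos : 0 < dist z a := dist_pos.2 hz
  have hsum : ∑ i, inner ℝ (z - a) (EuclideanSpace.single i (1 : ℝ)) ^ 2 = dist z a ^ 2 := by
    rw [dist_eq_norm, EuclideanSpace.real_norm_sq_eq]
    simp [EuclideanSpace.inner_single_right]
  simp only [d2_dist_rpow a _ hz, Finset.sum_add_distrib, ← Finset.mul_sum, hsum]
  have hexp : dist z a ^ (2 - (N : ℝ) - 2) = dist z a ^ (2 - (N : ℝ) - 4) * dist z a ^ 2 := by
    rw [← Real.rpow_natCast, ← Real.rpow_add hpos]
    congr 1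
    push_cast
    ring
  simp only [hexp, PiLp.norm_single, norm_one, one_pow, Finset.sum_const, Finset.card_univ,
    Fintype.card_fin, nsmul_eq_mul]
  ring

theorem contDiffOn_iterate_fderiv_apply {V : Type*} [NormedAddCommGroup V] [NormedSpace ℝ V]
    {f : V → ℝ} {U : Set V} (hU : IsOpen U) (hf : ContDiffOn ℝ (⊤ : ℕ∞) f U) (e : V) (l : ℕ) :
    ContDiffOn ℝ (⊤ : ℕ∞) ((fun g z => fderiv ℝ g z e)^[l] f) U := by
  induction l with
  | zero => exact hf
  | succ l ih =>
    rw [Function.iterate_succ_apply']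
    exact ih.fderiv_apply_const hU e

theorem HarmonicOnE.iterate_fderiv_apply {N : ℕ} {f : Euc N → ℝ} {U : Set (Euc N)}
    (hU : IsOpen U) (hf : ContDiffOn ℝ (⊤ : ℕ∞) f U) (h : HarmonicOnE f U) (e : Euc N) (l : ℕ) :
    HarmonicOnE ((fun g z => fderiv ℝ g z e)^[l] f) U := by
  induction l with
  | zero => exact h
  | succ l ih =>
    rw [Function.iterate_succ_apply']
    exact ih.fderiv_apply hU (contDiffOn_iterate_fderiv_apply hU hf e l) e

theorem isOpen_upperHS (n : ℕ) : IsOpen (upperHS n) :=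
  isOpen_lt continuous_const (by unfold tp; fun_prop)

@[simp]
theorem tp_pt {n : ℕ} (x : Euc n) (t : ℝ) : tp (pt x t) = t := by
  simp [tp, pt]

@[simp]
theorem pt_xp_tp {n : ℕ} (z : Euc (n + 1)) : pt (xp z) (tp z) = z := by
  ext i
  refine Fin.lastCases ?_ (fun i => ?_) i <;> simp [pt, xp, tp]

theorem pt_eq_add_smul {n : ℕ} (x : Euc n) (t : ℝ) :
    pt x t = pt x 0 + t • EuclideanSpace.single (Fin.last n) 1 := by
  ext i
  refine Fin.lastCases ?_ (fun i => ?_) i <;> simp [pt, (Fin.castSucc_lt_last _).ne]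

theorem hasDerivAt_pt {n : ℕ} (x : Euc n) (t : ℝ) :
    HasDerivAt (fun τ => pt x τ) (EuclideanSpace.single (Fin.last n) 1) t := by
  rw [funext (pt_eq_add_smul x)]
  simpa using ((hasDerivAt_id t).smul_const
    (EuclideanSpace.single (Fin.last n) (1 : ℝ))).const_add (pt x 0)

theorem iteratedDeriv_comp_pt {n : ℕ} {f : Euc (n + 1) → ℝ}
    (hf : ContDiffOn ℝ (⊤ : ℕ∞) f (upperHS n)) (l : ℕ) (x : Euc n) {t : ℝ} (ht : 0 < t) :
    iteratedDeriv l (fun τ => f (pt x τ)) t =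
      (fun g z => fderiv ℝ g z (EuclideanSpace.single (Fin.last n) 1))^[l] f (pt x t) := by
  induction l generalizing t with
  | zero => simp
  | succ l ih =>
    rw [iteratedDeriv_succ, Function.iterate_succ_apply']
    set F := (fun g z => fderiv ℝ g z (EuclideanSpace.single (Fin.last n) 1))^[l] f with hF
    have he : iteratedDeriv l (fun τ => f (pt x τ)) =ᶠ[nhds t] fun τ => F (pt x τ) := by
      filter_upwards [lt_mem_nhds ht] with τ hτ using ih hτ
    have hmem : pt x t ∈ upperHS n := by simpa [upperHS] using ht
    have hd : DifferentiableAt ℝ F (pt x t) :=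
      ((contDiffOn_iterate_fderiv_apply (isOpen_upperHS n) hf _ l).contDiffAt
        ((isOpen_upperHS n).mem_nhds hmem)).differentiableAt (by simp)
    rw [he.deriv_eq]
    exact (hd.hasFDerivAt.comp_hasDerivAt t (hasDerivAt_pt x t)).deriv

theorem harmonicOnE_fwl (n l : ℕ) (y : Euc n) {s : ℝ} (hs : 0 < s) :
    HarmonicOnE (fwl n l y s) (upperHS n) := by
  have hsub : upperHS n ⊆ {pt y (-s)}ᶜ := by
    rintro z hz rfl
    have : 0 < -s := by simpa [upperHS] using hz
    linarith
  have hcd := (contDiffOn_dist_rpow (pt y (-s)) (1 - (n : ℝ))).mono hsub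
  have hharm : HarmonicOnE (fun z => dist z (pt y (-s)) ^ (1 - (n : ℝ))) (upperHS n) := by
    have h := harmonicOnE_dist_rpow (pt y (-s))
    rw [show 2 - ((n + 1 : ℕ) : ℝ) = 1 - n by push_cast; ring] at h
    exact ⟨h.1.mono hsub, fun z hz => h.2 z (hsub hz)⟩
  refine (hharm.iterate_fderiv_apply (isOpen_upperHS n) hcd
    (EuclideanSpace.single (Fin.last n) 1) l).congr (isOpen_upperHS n) fun z hz => ?_
  rw [fwl]
  refine (iteratedDeriv_comp_pt hcd l (xp z) hz).trans ?_
  rw [pt_xp_tp]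

/-- the structure of the derivatives ∂^l/∂t^l (|z-w̄|^{1-n}), and their
harmonicity. -/
theorem stmt10 (n : ℕ) (hn : 2 ≤ n) (l : ℕ) :
    ∃ P : Polynomial ℤ, P.natDegree = l ∧
      (∀ (x y : Euc n) (t s : ℝ), 0 < t → 0 < s →
        iteratedDeriv l (fun τ => dB x τ y s ^ (1 - (n : ℝ))) t =
          dB x t y s ^ (-((n : ℝ) - 1 + l)) *
            Polynomial.aeval ((t + s) / dB x t y s) P) ∧
      (∀ (y : Euc n) (s : ℝ), 0 < s → HarmonicOnE (fwl n l y s) (upperHS n)) := by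
  exact ⟨derivPoly n l, natDegree_derivPoly hn l,
    fun x y _ _ ht hs => iteratedDeriv_dB_rpow x y l ht hs,
    fun y _ hs => harmonicOnE_fwl n l y hs⟩

end
end

section
/- Let n ≥ 1, δ > −1, γ > n + 1 + δ and m ∈ ℕ₀. There exists a constant C > 0 such that for every z = (x,t) ∈ ℝ^{n+1}_+: ∫_{ℝ^{n+1}_+} |Q_m(z,w)|^{γ/(n+m+1)} s^δ dy ds ≤ C t^{δ − γ + n + 1}, where w = (y,s). -/
open MeasureTheory Real Set
open scoped ENNReal

noncomputable section

/-- Lebesgue measure dy ds on ℝ^n × (0,∞) -/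
def baseM (n : ℕ) : Measure (Euc n × ℝ) :=
  (volume : Measure (Euc n)).prod ((volume : Measure ℝ).restrict (Ioi 0))

/-- the standard normalizing constant of the Poisson kernel for ℝ^{n+1}_+ -/
def cP (n : ℕ) : ℝ := Real.Gamma (((n : ℝ) + 1) / 2) / Real.pi ^ (((n : ℝ) + 1) / 2)

/-- the Poisson kernel P(x,t) = c_n t (|x|² + t²)^{-(n+1)/2} for ℝ^{n+1}_+ -/
def Pker (n : ℕ) (x : Euc n) (t : ℝ) : ℝ :=
  cP n * t / (‖x‖ ^ 2 + t ^ 2) ^ (((n : ℝ) + 1) / 2)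

/-- the harmonic Bergman kernel Q_m(z,w), z = (x,t), w = (y,s) -/
def Qker (n m : ℕ) (x : Euc n) (t : ℝ) (y : Euc n) (s : ℝ) : ℝ :=
  ((-2 : ℝ) ^ (m + 1) / (Nat.factorial m : ℝ)) *
    iteratedDeriv (m + 1) (fun u => Pker n (x - y) u) (t + s)

theorem hasDerivAt_pow_mul_rpow {r u : ℝ} (hu : 0 < u) (j : ℕ) (b : ℝ) :
    HasDerivAt (fun v : ℝ => v ^ j * (r ^ 2 + v ^ 2) ^ b)
      (j * (u ^ (j - 1) * (r ^ 2 + u ^ 2) ^ b) +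
        2 * b * (u ^ (j + 1) * (r ^ 2 + u ^ 2) ^ (b - 1))) u := by
  have h1 : HasDerivAt (fun v : ℝ => r ^ 2 + v ^ 2) (2 * u) u := by
    simpa using (hasDerivAt_pow 2 u).const_add (r ^ 2)
  have h2 := (hasDerivAt_pow j u).mul (h1.rpow_const (p := b) (Or.inl (by positivity)))
  refine h2.congr_deriv ?_
  ring

theorem contDiffAt_pow_mul_rpow {r u : ℝ} (hu : 0 < u) (j : ℕ) (b : ℝ) (k : WithTop ℕ∞) :
    ContDiffAt ℝ k (fun v : ℝ => v ^ j * (r ^ 2 + v ^ 2) ^ b) u := by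
  refine (contDiffAt_id.pow j).mul (ContDiffAt.rpow_const_of_ne ?_ (by positivity))
  exact contDiffAt_const.add (contDiffAt_id.pow 2)

theorem iteratedDeriv_succ_pow_mul_rpow {r u : ℝ} (hu : 0 < u) (k j : ℕ) (b : ℝ) :
    iteratedDeriv (k + 1) (fun v : ℝ => v ^ j * (r ^ 2 + v ^ 2) ^ b) u =
      j * iteratedDeriv k (fun v : ℝ => v ^ (j - 1) * (r ^ 2 + v ^ 2) ^ b) u +
      2 * b * iteratedDeriv k (fun v : ℝ => v ^ (j + 1) * (r ^ 2 + v ^ 2) ^ (b - 1)) u := by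
  rw [iteratedDeriv_succ']
  have h : deriv (fun v : ℝ => v ^ j * (r ^ 2 + v ^ 2) ^ b) =ᶠ[nhds u]
      fun v => j * (v ^ (j - 1) * (r ^ 2 + v ^ 2) ^ b) +
        2 * b * (v ^ (j + 1) * (r ^ 2 + v ^ 2) ^ (b - 1)) := by
    filter_upwards [lt_mem_nhds hu] with v hv
    exact (hasDerivAt_pow_mul_rpow hv j b).deriv
  rw [h.iteratedDeriv_eq,
    iteratedDeriv_fun_add (contDiffAt_const.mul (contDiffAt_pow_mul_rpow hu _ _ _))
      (contDiffAt_const.mul (contDiffAt_pow_mul_rpow hu _ _ _)),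
    iteratedDeriv_const_mul_field, iteratedDeriv_const_mul_field]

/-- The derivatives of `v ^ j * (r² + v²) ^ b` are bounded by a power of `r² + v²` of the same
homogeneity, uniformly in `r`. -/
theorem exists_abs_iteratedDeriv_pow_mul_rpow_le (k : ℕ) : ∀ (j : ℕ) (b : ℝ),
    ∃ C : ℝ, 0 ≤ C ∧ ∀ r u : ℝ, 0 < u →
      |iteratedDeriv k (fun v : ℝ => v ^ j * (r ^ 2 + v ^ 2) ^ b) u| ≤
        C * (r ^ 2 + u ^ 2) ^ (((j : ℝ) - k) / 2 + b) := by
  induction k with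
  | zero =>
    refine fun j b => ⟨1, zero_le_one, fun r u hu => ?_⟩
    have hR : 0 < r ^ 2 + u ^ 2 := by positivity
    have h1 : u ^ j ≤ (r ^ 2 + u ^ 2) ^ ((j : ℝ) / 2) := by
      calc u ^ j = (u ^ 2) ^ ((j : ℝ) / 2) := by
            rw [← rpow_natCast u 2, ← rpow_mul hu.le, ← rpow_natCast u j]
            congr 1
            push_cast
            ring
        _ ≤ _ := rpow_le_rpow (by positivity) (by nlinarith [sq_nonneg r]) (by positivity)
    rw [iteratedDeriv_zero, abs_of_nonneg (by positivity), one_mul, rpow_add hR]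
    simpa using mul_le_mul_of_nonneg_right h1 (rpow_nonneg hR.le b)
  | succ k ih =>
    intro j b
    obtain ⟨C₁, hC₁, h₁⟩ := ih (j - 1) b
    obtain ⟨C₂, hC₂, h₂⟩ := ih (j + 1) (b - 1)
    refine ⟨j * C₁ + |2 * b| * C₂, by positivity, fun r u hu => ?_⟩
    rw [iteratedDeriv_succ_pow_mul_rpow hu, add_mul]
    refine (abs_add_le _ _).trans (add_le_add ?_ ?_)
    · rcases Nat.eq_zero_or_pos j with rfl | hj
      · simp
      · rw [abs_mul, Nat.abs_cast, mul_assoc]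
        refine mul_le_mul_of_nonneg_left ((h₁ r u hu).trans_eq ?_) (by positivity)
        rw [Nat.cast_sub hj]
        congr 2
        push_cast
        ring
    · rw [abs_mul, mul_assoc]
      refine mul_le_mul_of_nonneg_left ((h₂ r u hu).trans_eq ?_) (by positivity)
      congr 2
      push_cast
      ring

theorem exists_abs_Qker_le (n m : ℕ) : ∃ K : ℝ, 0 ≤ K ∧ ∀ (x y : Euc n) (t s : ℝ), 0 < t + s →
    |Qker n m x t y s| ≤
      K * (‖x - y‖ ^ 2 + (t + s) ^ 2) ^ (-((n : ℝ) + m + 1) / 2) := by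
  obtain ⟨C, hC, h⟩ := exists_abs_iteratedDeriv_pow_mul_rpow_le (m + 1) 1 (-(((n : ℝ) + 1) / 2))
  refine ⟨|(-2 : ℝ) ^ (m + 1) / (Nat.factorial m : ℝ)| * (|cP n| * C), by positivity,
    fun x y t s hts => ?_⟩
  have hP : (fun u => Pker n (x - y) u) = fun u : ℝ =>
      cP n * (u ^ 1 * (‖x - y‖ ^ 2 + u ^ 2) ^ (-(((n : ℝ) + 1) / 2))) := by
    funext u
    rw [Pker, rpow_neg (by positivity), pow_one, div_eq_mul_inv, mul_assoc]
  rw [Qker, hP, iteratedDeriv_const_mul_field, abs_mul, abs_mul, mul_assoc, mul_assoc]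
  refine mul_le_mul_of_nonneg_left (mul_le_mul_of_nonneg_left
    ((h _ _ hts).trans_eq ?_) (abs_nonneg _)) (abs_nonneg _)
  congr 2
  push_cast
  ring

theorem exists_abs_Qker_rpow_le (n m : ℕ) {γ : ℝ} (hγ : 0 ≤ γ) : ∃ K : ℝ, 0 ≤ K ∧
    ∀ (x y : Euc n) (t s : ℝ), 0 < t + s →
      |Qker n m x t y s| ^ (γ / ((n : ℝ) + m + 1)) ≤
        K * (‖x - y‖ ^ 2 + (t + s) ^ 2) ^ (-γ / 2) := by
  obtain ⟨K, hK, h⟩ := exists_abs_Qker_le n m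
  refine ⟨K ^ (γ / ((n : ℝ) + m + 1)), by positivity, fun x y t s hts => ?_⟩
  refine (rpow_le_rpow (abs_nonneg _) (h x y t s hts) (by positivity)).trans_eq ?_
  rw [mul_rpow hK (by positivity), ← rpow_mul (by positivity)]
  congr 2
  field_simp

/-- Scaling identity for the integral of `(‖y‖² + τ²) ^ (-γ / 2)` over `ℝⁿ`. -/
theorem lintegral_norm_sq_add_sq_rpow (n : ℕ) {γ : ℝ} (hγ : (n : ℝ) < γ) (x : Euc n) {τ : ℝ}
    (hτ : 0 < τ) :
    ∫⁻ y : Euc n, ENNReal.ofReal ((‖x - y‖ ^ 2 + τ ^ 2) ^ (-γ / 2)) =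
      ENNReal.ofReal ((∫ y : Euc n, (1 + ‖y‖ ^ 2) ^ (-γ / 2)) * τ ^ ((n : ℝ) - γ)) := by
  have hint : Integrable (fun y : Euc n => (1 + ‖y‖ ^ 2) ^ (-γ / 2)) :=
    integrable_rpow_neg_one_add_norm_sq (by simpa using hγ)
  have hscale (y : Euc n) : (‖y‖ ^ 2 + τ ^ 2) ^ (-γ / 2) =
      τ ^ (-γ) * (1 + ‖τ⁻¹ • y‖ ^ 2) ^ (-γ / 2) := by
    have h1 : ‖y‖ ^ 2 + τ ^ 2 = τ ^ 2 * (1 + ‖τ⁻¹ • y‖ ^ 2) := by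
      rw [norm_smul, Real.norm_of_nonneg (by positivity)]
      field_simp
      ring
    rw [h1, mul_rpow (by positivity) (by positivity), ← rpow_natCast τ 2, ← rpow_mul hτ.le]
    congr 2
    push_cast
    ring
  rw [lintegral_sub_left_eq_self
    (fun y : Euc n => ENNReal.ofReal ((‖y‖ ^ 2 + τ ^ 2) ^ (-γ / 2))) x]
  simp_rw [hscale]
  rw [← ofReal_integral_eq_lintegral_ofReal
    ((hint.comp_smul (inv_ne_zero hτ.ne')).const_mul _)
    (Filter.Eventually.of_forall fun y => by positivity),
    integral_const_mul, Measure.integral_comp_smul volume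
      (fun y : Euc n => (1 + ‖y‖ ^ 2) ^ (-γ / 2)), finrank_euclideanSpace_fin, inv_pow, inv_inv,
    abs_of_nonneg (by positivity), smul_eq_mul, sub_eq_neg_add, rpow_add hτ, rpow_natCast]
  congr 1
  ring

theorem lintegral_rpow_mul_add_rpow_le {δ ρ t : ℝ} (hδ : -1 < δ) (hρ : δ + ρ < -1) (ht : 0 < t) :
    ∫⁻ s in Ioi (0 : ℝ), ENNReal.ofReal (s ^ δ * (t + s) ^ ρ) ≤
      ENNReal.ofReal (((δ + 1)⁻¹ + (-(δ + ρ + 1))⁻¹) * t ^ (δ + ρ + 1)) := by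
  have hρ0 : ρ ≤ 0 := by linarith
  rw [← Ioc_union_Ioi_eq_Ioi ht.le, add_mul, ENNReal.ofReal_add
    (mul_nonneg (inv_nonneg.2 (by linarith)) (by positivity))
    (mul_nonneg (inv_nonneg.2 (by linarith)) (by positivity))]
  refine (lintegral_union_le _ _ _).trans (add_le_add ?_ ?_)
  · have hint : IntegrableOn (fun s : ℝ => s ^ δ) (Ioc 0 t) :=
      (intervalIntegrable_iff_integrableOn_Ioc_of_le ht.le).1
        (intervalIntegral.intervalIntegrable_rpow' hδ)
    calc ∫⁻ s in Ioc 0 t, ENNReal.ofReal (s ^ δ * (t + s) ^ ρ)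
        ≤ ∫⁻ s in Ioc 0 t, ENNReal.ofReal (s ^ δ * t ^ ρ) := by
          refine setLIntegral_mono' measurableSet_Ioc fun s hs => ENNReal.ofReal_le_ofReal ?_
          exact mul_le_mul_of_nonneg_left
            (rpow_le_rpow_of_nonpos ht (by linarith [hs.1]) hρ0) (rpow_nonneg hs.1.le _)
      _ = ENNReal.ofReal (∫ s in Ioc 0 t, s ^ δ * t ^ ρ) := by
          refine (ofReal_integral_eq_lintegral_ofReal (hint.mul_const _) ?_).symm
          filter_upwards [ae_restrict_mem measurableSet_Ioc] with s hs
          exact mul_nonneg (rpow_nonneg hs.1.le _) (by positivity)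
      _ ≤ _ := by
          refine ENNReal.ofReal_le_ofReal (le_of_eq ?_)
          rw [integral_mul_const, ← intervalIntegral.integral_of_le ht.le,
            integral_rpow (Or.inl hδ), zero_rpow (by linarith),
            show δ + ρ + 1 = δ + 1 + ρ by ring, rpow_add ht (δ + 1)]
          ring
  · have hint : IntegrableOn (fun s : ℝ => s ^ (δ + ρ)) (Ioi t) :=
      integrableOn_Ioi_rpow_of_lt hρ ht
    calc ∫⁻ s in Ioi t, ENNReal.ofReal (s ^ δ * (t + s) ^ ρ)
        ≤ ∫⁻ s in Ioi t, ENNReal.ofReal (s ^ (δ + ρ)) := by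
          refine setLIntegral_mono' measurableSet_Ioi fun s hs => ENNReal.ofReal_le_ofReal ?_
          have hs0 : 0 < s := ht.trans hs
          rw [rpow_add hs0]
          exact mul_le_mul_of_nonneg_left
            (rpow_le_rpow_of_nonpos hs0 (by linarith) hρ0) (by positivity)
      _ = ENNReal.ofReal (∫ s in Ioi t, s ^ (δ + ρ)) := by
          refine (ofReal_integral_eq_lintegral_ofReal hint ?_).symm
          filter_upwards [ae_restrict_mem measurableSet_Ioi] with s hs
          exact rpow_nonneg (ht.trans hs).le _
      _ ≤ _ := by
          refine ENNReal.ofReal_le_ofReal (le_of_eq ?_)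
          rw [integral_Ioi_rpow_of_lt hρ ht, inv_neg, div_eq_inv_mul]
          ring

/-- the kernel integral estimate
∫ |Q_m(z,w)|^{γ/(n+m+1)} s^δ dy ds ≤ C t^{δ-γ+n+1}. -/
theorem stmt17 (n : ℕ) (hn : 1 ≤ n) (δ γ : ℝ) (hδ : -1 < δ)
    (hγ : γ > (n : ℝ) + 1 + δ) (m : ℕ) :
    ∃ C : ℝ, 0 < C ∧ ∀ (x : Euc n) (t : ℝ), 0 < t →
      (∫⁻ w : Euc n × ℝ,
          ENNReal.ofReal (|Qker n m x t w.1 w.2| ^ (γ / ((n : ℝ) + m + 1)) * w.2 ^ δ)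
          ∂(baseM n)) ≤
        ENNReal.ofReal (C * t ^ (δ - γ + (n : ℝ) + 1)) := by
  have hnγ : (n : ℝ) < γ := by linarith
  have hn0 : (0 : ℝ) ≤ n := n.cast_nonneg
  obtain ⟨K, hK, hQ⟩ := exists_abs_Qker_rpow_le n m (hn0.trans hnγ.le)
  set I : ℝ := ∫ y : Euc n, (1 + ‖y‖ ^ 2) ^ (-γ / 2)
  have hI : 0 ≤ I := integral_nonneg fun y => by positivity
  set J : ℝ := (δ + 1)⁻¹ + (-(δ + (n - γ) + 1))⁻¹
  have hJ : 0 ≤ J := add_nonneg (inv_nonneg.2 (by linarith)) (inv_nonneg.2 (by linarith))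
  refine ⟨K * I * J + 1, by positivity, fun x t ht => ?_⟩
  calc ∫⁻ w : Euc n × ℝ,
        ENNReal.ofReal (|Qker n m x t w.1 w.2| ^ (γ / ((n : ℝ) + m + 1)) * w.2 ^ δ) ∂(baseM n)
      ≤ ∫⁻ w : Euc n × ℝ, ENNReal.ofReal (K * w.2 ^ δ) *
          ENNReal.ofReal ((‖x - w.1‖ ^ 2 + (t + w.2) ^ 2) ^ (-γ / 2)) ∂(baseM n) := by
        refine lintegral_mono_ae ?_
        have hpos : ∀ᵐ w ∂(baseM n), w.2 ∈ Ioi (0 : ℝ) :=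
          Measure.quasiMeasurePreserving_snd.ae (ae_restrict_mem measurableSet_Ioi)
        filter_upwards [hpos] with w hw
        have hw : 0 < w.2 := hw
        rw [← ENNReal.ofReal_mul (by positivity), mul_right_comm]
        exact ENNReal.ofReal_le_ofReal (mul_le_mul_of_nonneg_right
          (hQ x w.1 t w.2 (by positivity)) (by positivity))
    _ = ∫⁻ s in Ioi (0 : ℝ), ∫⁻ y : Euc n, ENNReal.ofReal (K * s ^ δ) *
          ENNReal.ofReal ((‖x - y‖ ^ 2 + (t + s) ^ 2) ^ (-γ / 2)) :=
        lintegral_prod_symm _ (by fun_prop)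
    _ = ∫⁻ s in Ioi (0 : ℝ), ENNReal.ofReal (K * I) *
          ENNReal.ofReal (s ^ δ * (t + s) ^ ((n : ℝ) - γ)) := by
        refine setLIntegral_congr_fun measurableSet_Ioi fun s hs => ?_
        have hs : 0 < s := hs
        rw [lintegral_const_mul' _ _ ENNReal.ofReal_ne_top,
          lintegral_norm_sq_add_sq_rpow n hnγ x (by positivity : 0 < t + s),
          ← ENNReal.ofReal_mul (by positivity), ← ENNReal.ofReal_mul (by positivity)]
        congr 1
        ring
    _ ≤ ENNReal.ofReal (K * I) * ENNReal.ofReal (J * t ^ (δ + (n - γ) + 1)) := by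
        rw [lintegral_const_mul' _ _ ENNReal.ofReal_ne_top]
        gcongr
        exact lintegral_rpow_mul_add_rpow_le hδ (by linarith) ht
    _ ≤ _ := by
        rw [← ENNReal.ofReal_mul (by positivity), ← mul_assoc,
          show δ + ((n : ℝ) - γ) + 1 = δ - γ + n + 1 by ring]
        gcongr
        linarith

end
end
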